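/- Let I = [a,b] and let F : I → I be a PM function with forts c_1 < … < c_v (c_0 := a, c_{v+1} := b), v ≥ 2, such that F(I) ⊆ [c_0,c_1] (so H(F) = 1 and K(F) = [c_0,c_1]) and F is strictly increasing on [c_0,c_1]. Suppose the restriction of F to [c_0,c_1] is reversing-correspondence, and that F(c_0) > c_0, F(c_1) < c_1 and F(c_2) = c_0. Then F has a continuous iterative root f of order 2 (f : I → I continuous with f∘f = F) such that f is strictly decreasing on [c_0,c_1] and H(f) = 2. -/

import Mathlib

open Set Function

noncomputable section

/-- `x` is a fort of `F` on `[a,b]`: `F` is not strictly monotone on any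
neighborhood of `x` in `[a,b]`. -/
def IsFort (a b : ℝ) (F : ℝ → ℝ) (x : ℝ) : Prop :=
  x ∈ Set.Icc a b ∧ ∀ ε : ℝ, 0 < ε →
    ¬ StrictMonoOn F (Set.Icc a b ∩ Set.Ioo (x - ε) (x + ε)) ∧
    ¬ StrictAntiOn F (Set.Icc a b ∩ Set.Ioo (x - ε) (x + ε))

/-- The number of forts `N(F)` of `F` on `[a,b]`. -/
noncomputable def nForts (a b : ℝ) (F : ℝ → ℝ) : ℕ :=
  {x | IsFort a b F x}.ncard

/-- `H(F) = m`: the nonmonotonicity height of `F` on `[a,b]` equals `m`, i.e. `m` is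
the least `i ≥ 0` with `N(F^i) = N(F^{i+1})`. -/
def HeightEq (a b : ℝ) (F : ℝ → ℝ) (m : ℕ) : Prop :=
  IsLeast {i : ℕ | nForts a b (F^[i]) = nForts a b (F^[i + 1])} m

/-- `F` is a PM function on `[a,b]` with forts `c 1 < ... < c v`
(`c 0 = a`, `c (v+1) = b`): `F` is continuous, maps `[a,b]` into itself,
is strictly monotone on each lap `[c i, c (i+1)]`, and each `c i`, `1 ≤ i ≤ v`,
is a fort. -/
structure PMFun (a b : ℝ) (F : ℝ → ℝ) (v : ℕ) (c : ℕ → ℝ) : Prop where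
  lt : a < b
  cont : ContinuousOn F (Set.Icc a b)
  maps : Set.MapsTo F (Set.Icc a b) (Set.Icc a b)
  c_zero : c 0 = a
  c_last : c (v + 1) = b
  c_mono : ∀ i ≤ v, c i < c (i + 1)
  lap_mono : ∀ i ≤ v,
    StrictMonoOn F (Set.Icc (c i) (c (i + 1))) ∨ StrictAntiOn F (Set.Icc (c i) (c (i + 1)))
  fort : ∀ i, 1 ≤ i → i ≤ v → IsFort a b F (c i)

/-- `[d,e]` is a lap of `G` on `[a,b]`: a maximal interval of strict monotonicity,
bounded by forts or the endpoints of `[a,b]`, with no fort inside. -/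
def IsLap (a b : ℝ) (G : ℝ → ℝ) (d e : ℝ) : Prop :=
  a ≤ d ∧ d < e ∧ e ≤ b ∧
  (StrictMonoOn G (Set.Icc d e) ∨ StrictAntiOn G (Set.Icc d e)) ∧
  (d = a ∨ IsFort a b G d) ∧ (e = b ∨ IsFort a b G e) ∧
  ∀ x ∈ Set.Ioo d e, ¬ IsFort a b G x

/-- The set of fixed points of `φ` in `[α,β]`. -/
def fixedSet (α β : ℝ) (φ : ℝ → ℝ) : Set ℝ := {x | x ∈ Set.Icc α β ∧ φ x = x}

/-- `φ` is a reversing-correspondence on `[α,β]`. -/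
def RevCorr (α β : ℝ) (φ : ℝ → ℝ) : Prop :=
  StrictMonoOn φ (Set.Icc α β) ∧ ContinuousOn φ (Set.Icc α β) ∧
  Set.MapsTo φ (Set.Icc α β) (Set.Icc α β) ∧
  ∃ ξ ∈ fixedSet α β φ, ∃ ω : ℝ → ℝ,
    Set.MapsTo ω (fixedSet α β φ) (fixedSet α β φ) ∧
    StrictAntiOn ω (fixedSet α β φ) ∧
    Set.SurjOn ω (fixedSet α β φ) (fixedSet α β φ) ∧
    ω ξ = ξ ∧
    ((α ∈ fixedSet α β φ ∧ β ∈ fixedSet α β φ) ∨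
      (α ∉ fixedSet α β φ ∧ β ∉ fixedSet α β φ)) ∧
    (∀ ξ₁ ∈ fixedSet α β φ, ∀ ξ₂ ∈ fixedSet α β φ, ξ₁ < ξ₂ → ξ₂ ≤ ξ →
      (∀ z ∈ Set.Ioo ξ₁ ξ₂, z ∉ fixedSet α β φ) →
      ∀ x ∈ Set.Ioo ξ₁ ξ₂, ∀ y ∈ Set.Ioo (ω ξ₂) (ω ξ₁),
        (φ x - x) * (φ y - y) < 0)

lemma exists_gap {E : Set ℝ} {A B x : ℝ} (hE : IsCompact E) (hA : A ∈ E) (hB : B ∈ E)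
    (hx : x ∈ Icc A B) (hxE : x ∉ E) :
    ∃ e ∈ E, ∃ e' ∈ E, x ∈ Ioo e e' ∧ ∀ z ∈ Ioo e e', z ∉ E := by
  obtain ⟨e, ⟨heE, hex⟩, he⟩ :=
    (hE.inter_right (isClosed_Iic (a := x))).exists_isGreatest ⟨A, hA, hx.1⟩
  obtain ⟨e', ⟨heE', hex'⟩, he'⟩ :=
    (hE.inter_right (isClosed_Ici (a := x))).exists_isLeast ⟨B, hB, hx.2⟩
  refine ⟨e, heE, e', heE', ⟨lt_of_le_of_ne hex fun h => hxE (h ▸ heE),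
    lt_of_le_of_ne hex' fun h => hxE (h ▸ heE')⟩, fun z hz hzE => ?_⟩
  rcases le_total z x with h | h
  · exact (he ⟨hzE, h⟩).not_gt hz.1
  · exact (he' ⟨hzE, h⟩).not_gt hz.2

/-- A strictly decreasing map between compact sets extends across the gaps. -/
lemma exists_glue {E : Set ℝ} {A B : ℝ} (hE : IsCompact E) (hA : A ∈ E) (hB : B ∈ E)
    (hsub : E ⊆ Icc A B) {θ : ℝ → ℝ} (hθ : StrictAntiOn θ E) (hE' : IsCompact (θ '' E))
    {g : ℝ → ℝ → ℝ → ℝ}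
    (hg : ∀ e ∈ E, ∀ e' ∈ E, e < e' → (∀ z ∈ Ioo e e', z ∉ E) →
      StrictAntiOn (g e e') (Ioo e e') ∧ g e e' '' Ioo e e' = Ioo (θ e') (θ e)) :
    ∃ H : ℝ → ℝ, EqOn H θ E ∧
      (∀ e ∈ E, ∀ e' ∈ E, e < e' → (∀ z ∈ Ioo e e', z ∉ E) → EqOn H (g e e') (Ioo e e')) ∧
      StrictAntiOn H (Icc A B) ∧ H '' Icc A B = Icc (θ B) (θ A) := by
  classical
  have hgap : ∀ x, ∃ e e', x ∈ Icc A B → x ∉ E →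
      e ∈ E ∧ e' ∈ E ∧ x ∈ Ioo e e' ∧ ∀ z ∈ Ioo e e', z ∉ E := by
    intro x
    by_cases h : x ∈ Icc A B ∧ x ∉ E
    · obtain ⟨e, he, e', he', h1, h2⟩ := exists_gap hE hA hB h.1 h.2
      exact ⟨e, e', fun _ _ => ⟨he, he', h1, h2⟩⟩
    · exact ⟨0, 0, fun h1 h2 => (h ⟨h1, h2⟩).elim⟩
  choose l r hlr using hgap
  let H : ℝ → ℝ := fun x => if x ∈ E then θ x else g (l x) (r x) x
  have hHE : EqOn H θ E := fun x hx => if_pos hx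
  have hHg : ∀ e ∈ E, ∀ e' ∈ E, e < e' → (∀ z ∈ Ioo e e', z ∉ E) →
      EqOn H (g e e') (Ioo e e') := by
    intro e he e' he' _ hgap x hx
    have hxE := hgap x hx
    obtain ⟨h1, h2, h3, h4⟩ := hlr x
      ⟨(hsub he).1.trans hx.1.le, hx.2.le.trans (hsub he').2⟩ hxE
    have hl : l x = e := by
      rcases lt_trichotomy (l x) e with h | h | h
      · exact (h4 e ⟨h, hx.1.trans h3.2⟩ he).elim
      · exact h
      · exact (hgap _ ⟨h, h3.1.trans hx.2⟩ h1).elim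
    have hr : r x = e' := by
      rcases lt_trichotomy (r x) e' with h | h | h
      · exact (hgap _ ⟨hx.1.trans h3.2, h⟩ h2).elim
      · exact h
      · exact (h4 e' ⟨h3.1.trans hx.2, h⟩ he').elim
    simp only [H, if_neg hxE, hl, hr]
  have hmem : ∀ e ∈ E, ∀ e' ∈ E, (∀ z ∈ Ioo e e', z ∉ E) → ∀ x ∈ Ioo e e',
      H x ∈ Ioo (θ e') (θ e) := by
    intro e he e' he' hgap x hx
    have hlt := hx.1.trans hx.2
    rw [hHg e he e' he' hlt hgap hx, ← (hg e he e' he' hlt hgap).2]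
    exact mem_image_of_mem _ hx
  have hanti : StrictAntiOn H (Icc A B) := by
    intro x hx y hy hxy
    by_cases hxE : x ∈ E <;> by_cases hyE : y ∈ E
    · rw [hHE hxE, hHE hyE]; exact hθ hxE hyE hxy
    · obtain ⟨e, he, e', he', hye, hz⟩ := exists_gap hE hA hB hy hyE
      have hxe : x ≤ e := le_of_not_gt fun h => hz x ⟨h, hxy.trans hye.2⟩ hxE
      rw [hHE hxE]
      exact (hmem e he e' he' hz y hye).2.trans_le (hθ.antitoneOn hxE he hxe)
    · obtain ⟨e, he, e', he', hxe, hz⟩ := exists_gap hE hA hB hx hxE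
      have hye : e' ≤ y := le_of_not_gt fun h => hz y ⟨hxe.1.trans hxy, h⟩ hyE
      rw [hHE hyE]
      exact (hθ.antitoneOn he' hyE hye).trans_lt (hmem e he e' he' hz x hxe).1
    · obtain ⟨e, he, e', he', hxe, hz⟩ := exists_gap hE hA hB hx hxE
      obtain ⟨d, hd, d', hd', hyd, hw⟩ := exists_gap hE hA hB hy hyE
      have hlt := hxe.1.trans hxe.2
      rcases lt_or_ge y e' with h | h
      · have hye : y ∈ Ioo e e' := ⟨hxe.1.trans hxy, h⟩
        rw [hHg e he e' he' hlt hz hxe, hHg e he e' he' hlt hz hye]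
        exact (hg e he e' he' hlt hz).1 hxe hye hxy
      · have hed : e' ≤ d := le_of_not_gt fun h' => hw e' ⟨h', h.trans_lt hyd.2⟩ he'
        exact ((hmem d hd d' hd' hw y hyd).2.trans_le (hθ.antitoneOn he' hd hed)).trans
          (hmem e he e' he' hz x hxe).1
  have hAB : A ≤ B := (hsub hA).2
  refine ⟨H, hHE, hHg, hanti, Subset.antisymm ?_ ?_⟩
  · rintro _ ⟨x, hx, rfl⟩
    rw [← hHE hA, ← hHE hB]
    exact ⟨hanti.antitoneOn hx (right_mem_Icc.2 hAB) hx.2,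
      hanti.antitoneOn (left_mem_Icc.2 hAB) hx hx.1⟩
  · intro y hy
    by_cases hyE : y ∈ θ '' E
    · obtain ⟨x, hx, rfl⟩ := hyE
      exact ⟨x, hsub hx, hHE hx⟩
    · obtain ⟨_, ⟨e', he', rfl⟩, _, ⟨e, he, rfl⟩, hye, hz⟩ :=
        exists_gap hE' (mem_image_of_mem θ hB) (mem_image_of_mem θ hA) hy hyE
      have hlt : e < e' := (hθ.lt_iff_gt he' he).1 (hye.1.trans hye.2)
      have hgap : ∀ z ∈ Ioo e e', z ∉ E := fun z hz' hzE =>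
        hz (θ z) ⟨hθ hzE he' hz'.2, hθ he hzE hz'.1⟩ (mem_image_of_mem θ hzE)
      rw [← (hg e he e' he' hlt hgap).2] at hye
      obtain ⟨x, hx, rfl⟩ := hye
      exact ⟨x, ⟨(hsub he).1.trans hx.1.le, hx.2.le.trans (hsub he').2⟩,
        hHg e he e' he' hlt hgap hx⟩

/-- A fixed-point-free gap of an increasing homeomorphism is parametrized by the line so that
the homeomorphism becomes the unit translation. -/
lemma exists_translation_param (Φ : ℝ ≃o ℝ) {e e' p : ℝ} (he : Φ e = e) (he' : Φ e' = e')
    (hfix : ∀ z ∈ Ioo e e', Φ z ≠ z) (hp : p ∈ Ioo e e') (hpΦ : p < Φ p) :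
    ∃ T : ℝ → ℝ, StrictMono T ∧ range T = Ioo e e' ∧ T 0 = p ∧ ∀ t, T (t + 1) = Φ (T t) := by
  have hsucc : ∀ (n : ℤ) (x : ℝ), (Φ ^ (n + 1)) x = Φ ((Φ ^ n) x) := by
    intro n x; rw [add_comm, zpow_add, zpow_one]; rfl
  have hsucc' : ∀ (n : ℤ) (x : ℝ), (Φ ^ (n + 1)) x = (Φ ^ n) (Φ x) := by
    intro n x; rw [zpow_add, zpow_one]; rfl
  have hinv : ∀ (n : ℤ) (x : ℝ), (Φ ^ n) ((Φ ^ (-n)) x) = x := by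
    intro n x
    have : (Φ ^ n * Φ ^ (-n)) x = x := by rw [← zpow_add]; simp
    exact this
  have hpow : ∀ x, Φ x = x → ∀ n : ℤ, (Φ ^ n) x = x := by
    intro x hx n
    induction n with
    | zero => rfl
    | succ n ih => rw [hsucc, ih, hx]
    | pred n ih =>
      apply Φ.injective
      rw [← hsucc, hx]; simpa using ih
  have hmem : ∀ (n : ℤ) x, x ∈ Ioo e e' → (Φ ^ n) x ∈ Ioo e e' := fun n x hx =>
    ⟨by simpa [hpow e he n] using (Φ ^ n).strictMono hx.1,
      by simpa [hpow e' he' n] using (Φ ^ n).strictMono hx.2⟩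
  have horb : StrictMono fun n : ℤ => (Φ ^ n) p := strictMono_int_of_lt_succ fun n => by
    rw [hsucc']; exact (Φ ^ n).strictMono hpΦ
  have hup : ∀ x ∈ Ioo e e', ∃ n : ℤ, x < (Φ ^ n) p := by
    intro x hx
    by_contra! h
    have hbdd : BddAbove (range fun n : ℤ => (Φ ^ n) p) := ⟨x, by rintro _ ⟨n, rfl⟩; exact h n⟩
    set s := ⨆ n : ℤ, (Φ ^ n) p with hs
    have h1 : Φ s = s := by
      rw [hs, Φ.map_ciSup hbdd]
      simp_rw [← hsucc]
      exact (Equiv.addRight (1 : ℤ)).iSup_comp (g := fun n : ℤ => (Φ ^ n) p)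
    have h2 : p ≤ s := le_ciSup hbdd 0
    have h3 : s ≤ x := ciSup_le h
    exact hfix s ⟨hp.1.trans_le h2, h3.trans_lt hx.2⟩ h1
  have hdown : ∀ x ∈ Ioo e e', ∃ n : ℤ, (Φ ^ n) p ≤ x := by
    intro x hx
    by_contra! h
    have hbdd : BddBelow (range fun n : ℤ => (Φ ^ n) p) :=
      ⟨x, by rintro _ ⟨n, rfl⟩; exact (h n).le⟩
    set s := ⨅ n : ℤ, (Φ ^ n) p with hs
    have h1 : Φ s = s := by
      rw [hs, Φ.map_ciInf hbdd]
      simp_rw [← hsucc]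
      exact (Equiv.addRight (1 : ℤ)).iInf_comp (g := fun n : ℤ => (Φ ^ n) p)
    have h2 : s ≤ p := ciInf_le hbdd 0
    have h3 : x ≤ s := le_ciInf fun n => (h n).le
    exact hfix s ⟨hx.1.trans_le h3, h2.trans_lt hp.2⟩ h1
  have hd : 0 < Φ p - p := sub_pos.2 hpΦ
  let u : ℝ → ℝ := fun t => p + Int.fract t * (Φ p - p)
  have hu0 : ∀ t, p ≤ u t := fun t => by
    have := mul_nonneg (Int.fract_nonneg t) hd.le
    simp only [u]; linarith
  have hu1 : ∀ t, u t < Φ p := fun t => by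
    have := mul_lt_mul_of_pos_right (Int.fract_lt_one t) hd
    simp only [u]; linarith
  have hT1 : ∀ t, (Φ ^ ⌊t⌋) p ≤ (Φ ^ ⌊t⌋) (u t) := fun t => (Φ ^ ⌊t⌋).monotone (hu0 t)
  have hT2 : ∀ t, (Φ ^ ⌊t⌋) (u t) < (Φ ^ (⌊t⌋ + 1)) p := fun t => by
    rw [hsucc']; exact (Φ ^ ⌊t⌋).strictMono (hu1 t)
  refine ⟨fun t => (Φ ^ ⌊t⌋) (u t), ?_, Subset.antisymm ?_ ?_, ?_, ?_⟩
  · intro s t hst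
    rcases (Int.floor_mono hst.le).lt_or_eq with h | h
    · exact (hT2 s).trans_le ((horb.monotone h).trans (hT1 t))
    · have hf : Int.fract s < Int.fract t := by
        unfold Int.fract; rw [h]; linarith
      have := mul_lt_mul_of_pos_right hf hd
      simp only [h]
      exact (Φ ^ ⌊t⌋).strictMono (by simp only [u]; linarith)
  · rintro _ ⟨t, rfl⟩
    exact ⟨(hmem _ p hp).1.trans_le (hT1 t), (hT2 t).trans (hmem _ p hp).2⟩
  · intro x hx
    obtain ⟨m, hm⟩ := hup x hx
    obtain ⟨n, hn, hmax⟩ := Int.exists_greatest_of_bdd (P := fun n : ℤ => (Φ ^ n) p ≤ x)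
      ⟨m, fun z hz => (horb.lt_iff_lt.1 (hz.trans_lt hm)).le⟩ (hdown x hx)
    have hn' : x < (Φ ^ (n + 1)) p := lt_of_not_ge fun h => by have := hmax _ h; omega
    set y := (Φ ^ (-n)) x
    have hyx : (Φ ^ n) y = x := hinv n x
    have hy1 : p ≤ y := (Φ ^ n).le_iff_le.1 (by rwa [hyx])
    have hy2 : y < Φ p := (Φ ^ n).lt_iff_lt.1 (by rwa [hyx, ← hsucc'])
    set w := (y - p) / (Φ p - p) with hw
    have hw0 : 0 ≤ w := div_nonneg (by linarith) hd.le
    have hw1 : w < 1 := (div_lt_one hd).2 (by linarith)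
    have hfl : ⌊(n : ℝ) + w⌋ = n := by
      rw [Int.floor_intCast_add, Int.floor_eq_zero_iff.2 ⟨hw0, hw1⟩, add_zero]
    have hfr : Int.fract ((n : ℝ) + w) = w := by
      rw [Int.fract, hfl]; ring
    refine ⟨n + w, ?_⟩
    have : u (n + w) = y := by
      change p + Int.fract ((n : ℝ) + w) * (Φ p - p) = y
      rw [hfr, hw, div_mul_cancel₀ _ hd.ne']; ring
    simp only [this, hfl, hyx]
  · simp [u]
  · intro t
    simp only [u, Int.floor_add_one, Int.fract_add_one, hsucc]

lemma exists_translation_param' (Φ : ℝ ≃o ℝ) {e e' p : ℝ} (he : Φ e = e) (he' : Φ e' = e')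
    (hfix : ∀ z ∈ Ioo e e', Φ z ≠ z) (hp : p ∈ Ioo e e') (hpΦ : Φ p < p) :
    ∃ T : ℝ → ℝ, StrictMono T ∧ range T = Ioo e e' ∧ T 0 = p ∧ ∀ t, T (t - 1) = Φ (T t) := by
  obtain ⟨T, h1, h2, h3, h4⟩ := exists_translation_param Φ.symm (e := e) (e' := e') (p := p)
    (Φ.symm_apply_eq.2 he.symm) (Φ.symm_apply_eq.2 he'.symm)
    (fun z hz h => hfix z hz (Φ.symm_apply_eq.1 h).symm) hp (Φ.lt_symm_apply.2 hpΦ)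
  refine ⟨T, h1, h2, h3, fun t => ?_⟩
  have := h4 (t - 1)
  rw [sub_add_cancel] at this
  rw [this, Φ.apply_symm_apply]

/-- Gaps on which a homeomorphism moves points in opposite directions are conjugate by a
decreasing map with prescribed value at a point. -/
lemma exists_anti_conj_gap (Φ : ℝ ≃o ℝ) {e e' p d d' q : ℝ} (he : Φ e = e) (he' : Φ e' = e')
    (hfix : ∀ z ∈ Ioo e e', Φ z ≠ z) (hp : p ∈ Ioo e e') (hd : Φ d = d) (hd' : Φ d' = d')
    (hfix' : ∀ z ∈ Ioo d d', Φ z ≠ z) (hq : q ∈ Ioo d d') (hpq : (Φ p - p) * (Φ q - q) < 0) :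
    ∃ h : ℝ → ℝ, StrictAntiOn h (Ioo e e') ∧ h '' Ioo e e' = Ioo d d' ∧ h p = q ∧
      ∀ x ∈ Ioo e e', h (Φ x) = Φ (h x) := by
  obtain ⟨s, T, hT1, hT2, hT3, hT4, S, hS1, hS2, hS3, hS4⟩ : ∃ (s : ℝ) (T : ℝ → ℝ),
      StrictMono T ∧ range T = Ioo e e' ∧ T 0 = p ∧ (∀ t, T (t + s) = Φ (T t)) ∧
      ∃ S : ℝ → ℝ, StrictMono S ∧ range S = Ioo d d' ∧ S 0 = q ∧ ∀ t, S (t - s) = Φ (S t) := by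
    rcases mul_neg_iff.1 hpq with ⟨h1, h2⟩ | ⟨h1, h2⟩
    · obtain ⟨T, t1, t2, t3, t4⟩ := exists_translation_param Φ he he' hfix hp (sub_pos.1 h1)
      obtain ⟨S, s1, s2, s3, s4⟩ := exists_translation_param' Φ hd hd' hfix' hq (sub_neg.1 h2)
      exact ⟨1, T, t1, t2, t3, t4, S, s1, s2, s3, s4⟩
    · obtain ⟨T, t1, t2, t3, t4⟩ := exists_translation_param' Φ he he' hfix hp (sub_neg.1 h1)
      obtain ⟨S, s1, s2, s3, s4⟩ := exists_translation_param Φ hd hd' hfix' hq (sub_pos.1 h2)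
      exact ⟨-1, T, t1, t2, t3, t4, S, s1, s2, s3, by simpa using s4⟩
  have hh : ∀ t, S (-(invFun T (T t))) = S (-t) := fun t => by
    rw [leftInverse_invFun hT1.injective t]
  rw [← hT2, ← hS2]
  refine ⟨fun x => S (-(invFun T x)), ?_, ?_, ?_, ?_⟩
  · rintro _ ⟨t, rfl⟩ _ ⟨t', rfl⟩ h
    simp only [hh]
    exact hS1 (neg_lt_neg (hT1.lt_iff_lt.1 h))
  · ext y
    constructor
    · rintro ⟨x, -, rfl⟩
      exact mem_range_self _
    · rintro ⟨t, rfl⟩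
      exact ⟨T (-t), mem_range_self _, by simp only [hh, neg_neg]⟩
  · simp only [← hT3, hh, neg_zero, hS3]
  · rintro _ ⟨t, rfl⟩
    simp only [← hT4, hh, ← hS4]
    congr 1; ring

/-- A decreasing correspondence of fixed points which reverses the direction of motion on gaps
extends to a decreasing conjugacy. -/
lemma exists_anti_conj (Φ : ℝ ≃o ℝ) {E : Set ℝ} {A B p₀ q₀ : ℝ} (hE : IsCompact E)
    (hA : A ∈ E) (hB : B ∈ E) (hEfix : ∀ z, z ∈ E ↔ z ∈ Icc A B ∧ Φ z = z) {θ : ℝ → ℝ}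
    (hθ : StrictAntiOn θ E) (hE' : IsCompact (θ '' E))
    (hEfix' : ∀ z, z ∈ θ '' E ↔ z ∈ Icc (θ B) (θ A) ∧ Φ z = z)
    (hp₀ : p₀ ∈ Icc A B) (hp₀E : p₀ ∉ E)
    (hgap : ∀ e ∈ E, ∀ e' ∈ E, e < e' → (∀ z ∈ Ioo e e', z ∉ E) →
      ∃ p ∈ Ioo e e', ∃ q ∈ Ioo (θ e') (θ e), (Φ p - p) * (Φ q - q) < 0 ∧
        (p₀ ∈ Ioo e e' → p = p₀ ∧ q = q₀)) :
    ∃ H : ℝ → ℝ, StrictAntiOn H (Icc A B) ∧ H '' Icc A B = Icc (θ B) (θ A) ∧ H p₀ = q₀ ∧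
      EqOn H θ E ∧ ∀ x ∈ Icc A B, H (Φ x) = Φ (H x) := by
  have hsub : E ⊆ Icc A B := fun z hz => ((hEfix z).1 hz).1
  have hΦ : ∀ z ∈ E, Φ z = z := fun z hz => ((hEfix z).1 hz).2
  have hΦθ : ∀ z ∈ E, Φ (θ z) = θ z := fun z hz => ((hEfix' _).1 (mem_image_of_mem θ hz)).2
  have hg : ∀ e e', ∃ g : ℝ → ℝ, e ∈ E → e' ∈ E → e < e' → (∀ z ∈ Ioo e e', z ∉ E) →
      StrictAntiOn g (Ioo e e') ∧ g '' Ioo e e' = Ioo (θ e') (θ e) ∧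
      (p₀ ∈ Ioo e e' → g p₀ = q₀) ∧ ∀ x ∈ Ioo e e', g (Φ x) = Φ (g x) := by
    intro e e'
    by_cases h : e ∈ E ∧ e' ∈ E ∧ e < e' ∧ ∀ z ∈ Ioo e e', z ∉ E
    · obtain ⟨he, he', hlt, hz⟩ := h
      obtain ⟨p, hp, q, hq, hpq, heq⟩ := hgap e he e' he' hlt hz
      have hfix : ∀ z ∈ Ioo e e', Φ z ≠ z := fun z hz' hzΦ => hz z hz'
        ((hEfix z).2 ⟨⟨(hsub he).1.trans hz'.1.le, hz'.2.le.trans (hsub he').2⟩, hzΦ⟩)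
      have hfix' : ∀ z ∈ Ioo (θ e') (θ e), Φ z ≠ z := by
        intro z hz' hzΦ
        obtain ⟨x, hx, rfl⟩ := (hEfix' z).2
          ⟨⟨(hθ.antitoneOn he' hB (hsub he').2).trans hz'.1.le,
            hz'.2.le.trans (hθ.antitoneOn hA he (hsub he).1)⟩, hzΦ⟩
        exact hz x ⟨(hθ.lt_iff_gt hx he).1 hz'.2, (hθ.lt_iff_gt he' hx).1 hz'.1⟩ hx
      obtain ⟨g, h1, h2, h3, h4⟩ := exists_anti_conj_gap Φ (hΦ e he) (hΦ e' he') hfix hp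
        (hΦθ e' he') (hΦθ e he) hfix' hq hpq
      refine ⟨g, fun _ _ _ _ => ⟨h1, h2, fun h => ?_, h4⟩⟩
      rw [← (heq h).1, ← (heq h).2, h3]
    · exact ⟨id, fun h1 h2 h3 h4 => (h ⟨h1, h2, h3, h4⟩).elim⟩
  choose g hg using hg
  obtain ⟨H, hHE, hHg, hanti, himg⟩ := exists_glue hE hA hB hsub hθ hE' (g := g)
    fun e he e' he' hlt hz => ⟨(hg e e' he he' hlt hz).1, (hg e e' he he' hlt hz).2.1⟩
  refine ⟨H, hanti, himg, ?_, hHE, fun x hx => ?_⟩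
  · obtain ⟨e, he, e', he', hx, hz⟩ := exists_gap hE hA hB hp₀ hp₀E
    have hlt := hx.1.trans hx.2
    rw [hHg e he e' he' hlt hz hx]
    exact (hg e e' he he' hlt hz).2.2.1 hx
  · by_cases hxE : x ∈ E
    · rw [hΦ x hxE, hHE hxE, hΦθ x hxE]
    · obtain ⟨e, he, e', he', hx, hz⟩ := exists_gap hE hA hB hx hxE
      have hlt := hx.1.trans hx.2
      have hΦx : Φ x ∈ Ioo e e' := by
        have h1 := Φ.strictMono hx.1
        have h2 := Φ.strictMono hx.2
        rw [hΦ e he] at h1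
        rw [hΦ e' he'] at h2
        exact ⟨h1, h2⟩
      rw [hHg e he e' he' hlt hz hx, hHg e he e' he' hlt hz hΦx]
      exact (hg e e' he he' hlt hz).2.2.2 x hx

/-- An increasing self-map of `[α, β]` moving both endpoints inwards extends to a homeomorphism
of the line which fixes `α - 1` and `β + 1` and no other new point in between. -/
lemma exists_orderIso_extension {α β : ℝ} {φ : ℝ → ℝ} (hαβ : α < β)
    (hmono : StrictMonoOn φ (Icc α β)) (hcont : ContinuousOn φ (Icc α β))
    (hα : α < φ α) (hβ : φ β < β) :
    ∃ Φ : ℝ ≃o ℝ, EqOn Φ φ (Icc α β) ∧ Φ (α - 1) = α - 1 ∧ Φ (β + 1) = β + 1 ∧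
      (∀ x ∈ Ioo (α - 1) α, Φ x ≠ x) ∧ ∀ x ∈ Ioo β (β + 1), Φ x ≠ x := by
  have hle := hαβ.le
  set k := φ α - α + 1 with hk
  set l := β + 1 - φ β with hl
  have hk0 : 0 < k := by linarith
  have hl0 : 0 < l := by linarith
  set P : ℝ → ℝ := fun x => IccExtend hle (domRestrict (Icc α β) φ) x with hP
  have hPc : Continuous P := (hcont.domRestrict).Icc_extend'
  have hPin : ∀ x ∈ Icc α β, P x = φ x := fun x hx => by
    rw [hP]; simp only [IccExtend_of_mem hle _ hx, domRestrict_apply]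
  have hPl : ∀ x ≤ α, P x = φ α := fun x hx => by
    rw [hP]; simp only [IccExtend_of_le_left hle _ hx, domRestrict_apply]
  have hPr : ∀ x, β ≤ x → P x = φ β := fun x hx => by
    rw [hP]; simp only [IccExtend_of_right_le hle _ hx, domRestrict_apply]
  let G : ℝ → ℝ := fun x => P x + (k * min (x - α) 0 + l * max (x - β) 0)
  have hGc : Continuous G := by fun_prop
  have hGl : ∀ x ≤ α, G x = φ α + k * (x - α) := fun x hx => by
    simp only [G]
    rw [hPl x hx, min_eq_left (by linarith), max_eq_right (by linarith)]; ring
  have hGr : ∀ x, β ≤ x → G x = φ β + l * (x - β) := fun x hx => by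
    simp only [G]
    rw [hPr x hx, min_eq_right (by linarith), max_eq_left (by linarith)]; ring
  have hGin : ∀ x ∈ Icc α β, G x = φ x := fun x hx => by
    simp only [G]
    rw [hPin x hx, min_eq_right (by linarith [hx.1]), max_eq_right (by linarith [hx.2])]; ring
  have hG1 : StrictMonoOn G (Iic α) := fun x hx y hy hxy => by
    rw [hGl x hx, hGl y hy]
    have := mul_lt_mul_of_pos_left hxy hk0
    linarith
  have hG2 : StrictMonoOn G (Icc α β) := fun x hx y hy hxy => by
    rw [hGin x hx, hGin y hy]; exact hmono hx hy hxy
  have hG3 : StrictMonoOn G (Ici β) := fun x hx y hy hxy => by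
    rw [hGr x hx, hGr y hy]
    have := mul_lt_mul_of_pos_left hxy hl0
    linarith
  have hG23 : StrictMonoOn G (Ici α) := by
    rw [← Icc_union_Ici_eq_Ici hle]
    exact hG2.union hG3 (isGreatest_Icc hle) isLeast_Ici
  have hGm : StrictMono G := hG1.Iic_union_Ici hG23
  have hsurj : Function.Surjective G := by
    refine hGc.surjective ?_ ?_
    · refine Filter.Tendsto.congr' (f₁ := fun x => φ β + l * (x - β)) ?_ ?_
      · filter_upwards [Filter.eventually_ge_atTop β] with x hx using (hGr x hx).symm
      · exact Filter.tendsto_atTop_add_const_left _ _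
          ((Filter.tendsto_atTop_add_const_right _ (-β) Filter.tendsto_id).const_mul_atTop hl0)
    · refine Filter.Tendsto.congr' (f₁ := fun x => φ α + k * (x - α)) ?_ ?_
      · filter_upwards [Filter.eventually_le_atBot α] with x hx using (hGl x hx).symm
      · exact Filter.tendsto_atBot_add_const_left _ _
          ((Filter.tendsto_atBot_add_const_right _ (-α) Filter.tendsto_id).const_mul_atBot hk0)
  refine ⟨hGm.orderIsoOfSurjective G hsurj, hGin, ?_, ?_, ?_, ?_⟩
  · change G _ = _
    rw [hGl _ (by linarith), hk]; ring
  · change G _ = _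
    rw [hGr _ (by linarith), hl]; ring
  · intro x hx
    change G _ ≠ _
    rw [hGl x hx.2.le]
    have := mul_pos (sub_pos.2 hα) (sub_pos.2 hx.1)
    exact ne_of_gt (by rw [hk]; nlinarith)
  · intro x hx
    change G _ ≠ _
    rw [hGr x hx.1.le]
    have := mul_pos (sub_pos.2 hβ) (sub_pos.2 hx.2)
    exact ne_of_lt (by rw [hl]; nlinarith)

lemma StrictAntiOn.exists_inverse {g : ℝ → ℝ} {p q r s : ℝ} (hg : StrictAntiOn g (Icc p q))
    (himg : g '' Icc p q = Icc r s) :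
    ∃ g' : ℝ → ℝ, StrictAntiOn g' (Icc r s) ∧ g' '' Icc r s = Icc p q ∧
      (∀ x ∈ Icc p q, g' (g x) = x) ∧ ∀ y ∈ Icc r s, g (g' y) = y := by
  have hl : ∀ x ∈ Icc p q, invFunOn g (Icc p q) (g x) = x := hg.injOn.leftInvOn_invFunOn
  have hr : ∀ y ∈ Icc r s, g (invFunOn g (Icc p q) y) = y := fun y hy =>
    invFunOn_eq (himg.symm ▸ hy : y ∈ g '' Icc p q)
  rw [← himg] at hr ⊢
  refine ⟨invFunOn g (Icc p q), ?_, ?_, hl, hr⟩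
  · rintro _ ⟨x, hx, rfl⟩ _ ⟨y, hy, rfl⟩ h
    rw [hl x hx, hl y hy]
    exact (hg.lt_iff_gt hx hy).1 h
  · exact LeftInvOn.image_image hl

lemma isCompact_fixedSet {α β : ℝ} {φ : ℝ → ℝ} (hcont : ContinuousOn φ (Icc α β)) :
    IsCompact (fixedSet α β φ) := by
  have h : fixedSet α β φ = Icc α β ∩ (fun x => φ x - x) ⁻¹' {0} := by
    ext x; simp [fixedSet, sub_eq_zero]
  rw [h]
  exact isCompact_Icc.of_isClosed_subset
    ((hcont.sub continuousOn_id).preimage_isClosed_of_isClosed isClosed_Icc isClosed_singleton)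
    inter_subset_left

/-- The two halves of a reversing-correspondence are conjugate by a decreasing map. -/
lemma RevCorr.exists_anti_conj {α β : ℝ} {φ : ℝ → ℝ} (hrev : RevCorr α β φ) (hα : α < φ α)
    (hβ : φ β < β) :
    ∃ ξ ∈ Icc α (φ β), φ ξ = ξ ∧ ∃ h : ℝ → ℝ, StrictAntiOn h (Icc α ξ) ∧
      h '' Icc α ξ = Icc ξ (φ β) ∧ ∀ x ∈ Icc α ξ, h (φ x) = φ (h x) := by
  obtain ⟨hmono, hcont, hmaps, ξ, hξ, ω, hωm, hωa, hωs, hωξ, -, hsgn⟩ := hrev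
  have hαβ : α < β := by
    refine lt_of_le_of_ne (hξ.1.1.trans hξ.1.2) ?_
    rintro rfl
    exact hα.not_gt hβ
  have hβK : β ∈ Icc α β := right_mem_Icc.2 hαβ.le
  have hαK : α ∈ Icc α β := left_mem_Icc.2 hαβ.le
  have hlow : ∀ x ∈ fixedSet α β φ, α < x := fun x hx =>
    lt_of_le_of_ne hx.1.1 fun h => hα.ne' (h ▸ hx.2)
  have hupp : ∀ x ∈ fixedSet α β φ, x < φ β := fun x hx => by
    have : x < β := lt_of_le_of_ne hx.1.2 fun h => hβ.ne (h ▸ hx.2)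
    simpa only [hx.2] using hmono hx.1 hβK this
  obtain ⟨Φ, hΦφ, hΦA, hΦB, hfixA, hfixB⟩ := exists_orderIso_extension hαβ hmono hcont hα hβ
  set E := fixedSet α β φ
  have hEc : IsCompact E := isCompact_fixedSet hcont
  have hΦE : ∀ z ∈ E, Φ z = z := fun z hz => (hΦφ hz.1).trans hz.2
  have hfix : ∀ z ∈ Icc (α - 1) (β + 1), Φ z = z → z = α - 1 ∨ z = β + 1 ∨ z ∈ E := by
    intro z hz hzΦ
    rcases hz.1.eq_or_lt with h | h
    · exact Or.inl h.symm
    rcases hz.2.eq_or_lt with h' | h'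
    · exact Or.inr (Or.inl h')
    have h1 : α ≤ z := le_of_not_gt fun h1 => hfixA z ⟨h, h1⟩ hzΦ
    have h2 : z ≤ β := le_of_not_gt fun h2 => hfixB z ⟨h2, h'⟩ hzΦ
    exact Or.inr (Or.inr ⟨⟨h1, h2⟩, (hΦφ ⟨h1, h2⟩).symm.trans hzΦ⟩)
  classical
  let θ : ℝ → ℝ := fun x => if x = α - 1 then β + 1 else ω x
  have hθA : θ (α - 1) = β + 1 := if_pos rfl
  have hθE : ∀ x ∈ E, θ x = ω x := fun x hx => if_neg (by have := hlow x hx; linarith)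
  have hθξ : θ ξ = ξ := (hθE ξ hξ).trans hωξ
  have himg : θ '' insert (α - 1) (E ∩ Iic ξ) = insert (β + 1) (E ∩ Ici ξ) := by
    rw [image_insert_eq, hθA]
    congr 1
    ext y
    constructor
    · rintro ⟨x, ⟨hx, hxξ⟩, rfl⟩
      rw [hθE x hx]
      exact ⟨hωm hx, hωξ ▸ hωa.antitoneOn hx hξ hxξ⟩
    · rintro ⟨hy, hyξ⟩
      obtain ⟨x, hx, rfl⟩ := hωs hy
      refine ⟨x, ⟨hx, mem_Iic.2 (not_lt.1 fun h => ?_)⟩, hθE x hx⟩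
      have := hωa hξ hx h
      rw [hωξ] at this
      exact this.not_ge hyξ
  have hξα := hlow ξ hξ
  have hξβ := hupp ξ hξ
  obtain ⟨H, hH, hHimg, hHα, hHθ, hHΦ⟩ := _root_.exists_anti_conj Φ
    (E := insert (α - 1) (E ∩ Iic ξ)) (A := α - 1) (B := ξ) (p₀ := α) (q₀ := φ β) (θ := θ)
    ((hEc.inter_right isClosed_Iic).insert _) (mem_insert _ _) (Or.inr ⟨hξ, self_mem_Iic⟩)
    (fun z => by
      constructor
      · rintro (rfl | ⟨hz, hzξ⟩)
        · exact ⟨⟨le_rfl, by linarith⟩, hΦA⟩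
        · exact ⟨⟨by linarith [hlow z hz], hzξ⟩, hΦE z hz⟩
      · rintro ⟨hz, hzΦ⟩
        rcases hfix z ⟨hz.1, by linarith [hz.2]⟩ hzΦ with h | h | h
        · exact Or.inl h
        · linarith [hz.2]
        · exact Or.inr ⟨h, hz.2⟩)
    (by
      rintro x (rfl | ⟨hx, hxξ⟩) y (rfl | ⟨hy, hyξ⟩) hxy
      · exact (lt_irrefl _ hxy).elim
      · rw [hθA, hθE y hy]
        linarith [hupp _ (hωm hy)]
      · linarith [hlow x hx]
      · rw [hθE x hx, hθE y hy]; exact hωa hx hy hxy)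
    (by rw [himg]; exact (hEc.inter_right isClosed_Ici).insert _)
    (fun z => by
      rw [himg, hθA, hθξ]
      constructor
      · rintro (rfl | ⟨hz, hzξ⟩)
        · exact ⟨⟨by linarith, le_rfl⟩, hΦB⟩
        · exact ⟨⟨hzξ, by linarith [hupp z hz]⟩, hΦE z hz⟩
      · rintro ⟨hz, hzΦ⟩
        rcases hfix z ⟨by linarith [hz.1], hz.2⟩ hzΦ with h | h | h
        · linarith [hz.1]
        · exact Or.inl h
        · exact Or.inr ⟨h, hz.1⟩)
    ⟨by linarith, hξα.le⟩
    (by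
      rintro (h | ⟨h, -⟩)
      · linarith
      · exact (hlow α h).false)
    (by
      rintro e he e' (rfl | ⟨he', heξ'⟩) hlt hz
      · rcases he with rfl | ⟨he, -⟩
        · exact (lt_irrefl _ hlt).elim
        · linarith [hlow e he]
      rw [hθE e' he']
      rcases he with rfl | ⟨he, heξ⟩
      · have hφβ : φ β ∈ Icc α β := hmaps hβK
        refine ⟨α, ⟨by linarith, hlow e' he'⟩, φ β, ⟨hupp _ (hωm he'), by rw [hθA]; linarith⟩,
          ?_, fun _ => ⟨rfl, rfl⟩⟩
        rw [hΦφ hαK, hΦφ hφβ]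
        exact mul_neg_of_pos_of_neg (sub_pos.2 hα) (sub_neg.2 (hmono hφβ hβK hβ))
      · rw [hθE e he]
        obtain ⟨p, hp⟩ := exists_between hlt
        obtain ⟨q, hq⟩ := exists_between (hωa he he' hlt)
        refine ⟨p, hp, q, hq, ?_, fun h => (h.1.trans (hlow e he)).false.elim⟩
        rw [hΦφ ⟨he.1.1.trans hp.1.le, hp.2.le.trans he'.1.2⟩,
          hΦφ ⟨(hωm he').1.1.trans hq.1.le, hq.2.le.trans (hωm he).1.2⟩]
        exact hsgn e he e' he' hlt heξ'
          (fun z hz' hzE => hz z hz' (Or.inr ⟨hzE, hz'.2.le.trans heξ'⟩)) p hp q hq)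
  rw [hθA, hθξ] at hHimg
  have hHξ : H ξ = ξ := (hHθ (Or.inr ⟨hξ, self_mem_Iic⟩)).trans hθξ
  have hsub : Icc α ξ ⊆ Icc (α - 1) ξ := Icc_subset_Icc_left (by linarith)
  have hHI : ∀ x ∈ Icc α ξ, H x ∈ Icc ξ (φ β) := fun x hx =>
    ⟨hHξ ▸ hH.antitoneOn (hsub hx) (hsub (right_mem_Icc.2 hξα.le)) hx.2,
      hHα ▸ hH.antitoneOn (hsub (left_mem_Icc.2 hξα.le)) (hsub hx) hx.1⟩
  refine ⟨ξ, ⟨hξα.le, hξβ.le⟩, hξ.2, H, hH.mono hsub, Subset.antisymm ?_ ?_, fun x hx => ?_⟩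
  · rintro _ ⟨x, hx, rfl⟩
    exact hHI x hx
  · intro y hy
    have : y ∈ H '' Icc (α - 1) ξ := hHimg ▸ ⟨hy.1, by linarith [hy.2]⟩
    obtain ⟨x, hx, rfl⟩ := this
    refine ⟨x, ⟨?_, hx.2⟩, rfl⟩
    exact (hH.le_iff_ge hx (hsub (left_mem_Icc.2 hξα.le))).1 (hHα.symm ▸ hy.2)
  · have hx' := hHI x hx
    rw [← hΦφ ⟨hx.1, hx.2.trans hξ.1.2⟩, hHΦ x (hsub hx),
      hΦφ ⟨hξα.le.trans hx'.1, hx'.2.trans hβ.le⟩]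

/-- A reversing-correspondence moving both endpoints inwards has a decreasing square root which
maps the right endpoint to the left one. -/
lemma RevCorr.exists_anti_root {α β : ℝ} {φ : ℝ → ℝ} (hrev : RevCorr α β φ) (hα : α < φ α)
    (hβ : φ β < β) :
    ∃ k : ℝ → ℝ, StrictAntiOn k (Icc α β) ∧ k '' Icc α β = Icc α (φ β) ∧
      ∀ x ∈ Icc α β, k (k x) = φ x := by
  obtain ⟨ξ, hξ, hφξ, h, hh, himg, hconj⟩ := hrev.exists_anti_conj hα hβ
  have hmono := hrev.1
  have hcont := hrev.2.1
  obtain ⟨g, hg, hgimg, hgh, hhg⟩ := hh.exists_inverse himg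
  have hξβ : ξ ≤ β := hξ.2.trans hβ.le
  have hβK : β ∈ Icc α β := right_mem_Icc.2 (hξ.1.trans hξβ)
  have hξK : ξ ∈ Icc α β := ⟨hξ.1, hξβ⟩
  have hξl : ξ ∈ Icc α ξ := right_mem_Icc.2 hξ.1
  have hξr : ξ ∈ Icc ξ (φ β) := left_mem_Icc.2 hξ.2
  have hhm : ∀ x ∈ Icc α ξ, h x ∈ Icc ξ (φ β) := fun x hx => himg ▸ mem_image_of_mem h hx
  have hgm : ∀ x ∈ Icc ξ (φ β), g x ∈ Icc α ξ := fun x hx => hgimg ▸ mem_image_of_mem g hx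
  have hhξ : h ξ = ξ := by
    refine le_antisymm ?_ (hhm ξ hξl).1
    have hξ' : ξ ∈ h '' Icc α ξ := himg ▸ hξr
    obtain ⟨y, hy, hyξ⟩ := hξ'
    calc h ξ ≤ h y := hh.antitoneOn hy hξl hy.2
      _ = ξ := hyξ
  have hgξ : g ξ = ξ := by simpa only [hhξ] using hgh ξ hξl
  have hφl : ∀ x ∈ Icc α ξ, φ x ∈ Icc α ξ := fun x hx =>
    ⟨(hrev.2.2.1 ⟨hx.1, hx.2.trans hξβ⟩).1,
      hφξ ▸ hmono.monotoneOn ⟨hx.1, hx.2.trans hξβ⟩ hξK hx.2⟩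
  have hφr : ∀ x ∈ Icc ξ β, φ x ∈ Icc ξ (φ β) := fun x hx =>
    ⟨hφξ ▸ hmono.monotoneOn hξK ⟨hξ.1.trans hx.1, hx.2⟩ hx.1,
      hmono.monotoneOn ⟨hξ.1.trans hx.1, hx.2⟩ hβK hx.2⟩
  classical
  let k : ℝ → ℝ := fun x => if x ≤ ξ then h x else g (φ x)
  have hkl : ∀ x ∈ Icc α ξ, k x = h x := fun x hx => if_pos hx.2
  have hkr : ∀ x ∈ Icc ξ β, k x = g (φ x) := fun x hx => by
    rcases hx.1.eq_or_lt with rfl | h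
    · rw [hkl _ hξl, hφξ, hgξ, hhξ]
    · exact if_neg h.not_ge
  have hkanti : StrictAntiOn k (Icc α β) := by
    rw [← Icc_union_Icc_eq_Icc hξ.1 hξβ]
    refine StrictAntiOn.union (fun x hx y hy hxy => ?_) (fun x hx y hy hxy => ?_)
      (isGreatest_Icc hξ.1) (isLeast_Icc hξβ)
    · rw [hkl x hx, hkl y hy]; exact hh hx hy hxy
    · rw [hkr x hx, hkr y hy]
      exact hg (hφr x hx) (hφr y hy)
        (hmono ⟨hξ.1.trans hx.1, hx.2⟩ ⟨hξ.1.trans hy.1, hy.2⟩ hxy)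
  refine ⟨k, hkanti, Subset.antisymm ?_ ?_, fun x hx => ?_⟩
  · rintro _ ⟨x, hx, rfl⟩
    rcases le_total x ξ with hxξ | hxξ
    · rw [hkl x ⟨hx.1, hxξ⟩]
      exact Icc_subset_Icc_left hξ.1 (hhm x ⟨hx.1, hxξ⟩)
    · rw [hkr x ⟨hxξ, hx.2⟩]
      exact Icc_subset_Icc_right hξ.2 (hgm _ (hφr x ⟨hxξ, hx.2⟩))
  · intro y hy
    rcases le_total ξ y with hyξ | hyξ
    · have hy' : y ∈ h '' Icc α ξ := himg ▸ ⟨hyξ, hy.2⟩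
      obtain ⟨x, hx, rfl⟩ := hy'
      exact ⟨x, ⟨hx.1, hx.2.trans hξβ⟩, hkl x hx⟩
    · have hy' : y ∈ g '' Icc ξ (φ β) := hgimg ▸ ⟨hy.1, hyξ⟩
      obtain ⟨z, hz, rfl⟩ := hy'
      have hz' : z ∈ Icc (φ ξ) (φ β) := hφξ.symm ▸ hz
      obtain ⟨x, hx, rfl⟩ :=
        intermediate_value_Icc hξβ (hcont.mono (Icc_subset_Icc_left hξ.1)) hz'
      exact ⟨x, ⟨hξ.1.trans hx.1, hx.2⟩, hkr x hx⟩
  · rcases le_total x ξ with hxξ | hxξ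
    · have hx' : x ∈ Icc α ξ := ⟨hx.1, hxξ⟩
      have := hhm x hx'
      rw [hkl x hx', hkr (h x) ⟨this.1, this.2.trans hβ.le⟩, ← hconj x hx', hgh _ (hφl x hx')]
    · have hx' : x ∈ Icc ξ β := ⟨hxξ, hx.2⟩
      rw [hkr x hx', hkl _ (hgm _ (hφr x hx')), hhg _ (hφr x hx')]

lemma AntitoneOn.continuousOn_of_image_Icc {g : ℝ → ℝ} {p q r s : ℝ}
    (hg : AntitoneOn g (Icc p q)) (himg : g '' Icc p q = Icc r s) :
    ContinuousOn g (Icc p q) := by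
  have hm : MapsTo g (Icc p q) (Icc r s) := fun x hx => himg ▸ mem_image_of_mem g hx
  let G : Icc p q → (Icc r s)ᵒᵈ := fun x => OrderDual.toDual (hm.restrict g _ _ x)
  have hG : Monotone G := fun x y hxy => hg x.2 y.2 hxy
  have hGs : Function.Surjective G := fun y => by
    have hy : ((OrderDual.ofDual y : Icc r s) : ℝ) ∈ g '' Icc p q := by
      rw [himg]; exact (OrderDual.ofDual y : Icc r s).2
    obtain ⟨x, hx, hxy⟩ := hy
    exact ⟨⟨x, hx⟩, Subtype.ext hxy⟩
  exact continuousOn_iff_continuous_domRestrict.2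
    (continuous_subtype_val.comp (continuous_ofDual.comp (hG.continuous_of_surjective hGs)))

/-- A decreasing square root on the characteristic interval `[a, c₁]` extends to a square root
whose range goes beyond that interval. -/
lemma exists_root_extension {a c₁ c₂ c₃ b : ℝ} {F k : ℝ → ℝ} (h₁ : a < c₁) (h₂ : c₁ < c₂)
    (h₃ : c₂ < c₃) (hb : c₃ ≤ b) (hF : ContinuousOn F (Icc a b))
    (hK : MapsTo F (Icc a b) (Icc a c₁)) (hF₂ : StrictAntiOn F (Icc c₁ c₂))
    (hF₃ : StrictMonoOn F (Icc c₂ c₃)) (hFc₂ : F c₂ = a) (hk : StrictAntiOn k (Icc a c₁))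
    (hkimg : k '' Icc a c₁ = Icc a (F c₁)) (hkk : ∀ x ∈ Icc a c₁, k (k x) = F x) :
    ∃ f : ℝ → ℝ, ContinuousOn f (Icc a b) ∧ MapsTo f (Icc a b) (Icc a b) ∧
      (∀ x ∈ Icc a b, f (f x) = F x) ∧ StrictAntiOn f (Icc a c₁) ∧
      StrictMonoOn f (Icc c₁ c₃) := by
  have hFimg : F '' Icc c₁ c₂ = Icc a (F c₁) := by
    refine Subset.antisymm ?_ ?_
    · rintro _ ⟨x, hx, rfl⟩
      exact ⟨(hK ⟨h₁.le.trans hx.1, by linarith [hx.2]⟩).1,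
        hF₂.antitoneOn (left_mem_Icc.2 h₂.le) hx hx.1⟩
    · rw [← hFc₂]
      exact intermediate_value_Icc' h₂.le (hF.mono (Icc_subset_Icc h₁.le (h₃.le.trans hb)))
  obtain ⟨k', hk', hk'img, hk'k, hkk'⟩ := hk.exists_inverse hkimg
  obtain ⟨G, hG, hGimg, hGF, hFG⟩ := hF₂.exists_inverse hFimg
  have hkc := hk.antitoneOn.continuousOn_of_image_Icc hkimg
  have hk'c := hk'.antitoneOn.continuousOn_of_image_Icc hk'img
  have hGc := hG.antitoneOn.continuousOn_of_image_Icc hGimg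
  have hkm : MapsTo k (Icc a c₁) (Icc a (F c₁)) := fun x hx => hkimg ▸ mem_image_of_mem k hx
  have hk'm : MapsTo k' (Icc a (F c₁)) (Icc a c₁) := fun x hx =>
    hk'img ▸ mem_image_of_mem k' hx
  have hGm : MapsTo G (Icc a (F c₁)) (Icc c₁ c₂) := fun x hx => hGimg ▸ mem_image_of_mem G hx
  have hFm : MapsTo F (Icc c₁ c₂) (Icc a (F c₁)) := fun x hx => hFimg ▸ mem_image_of_mem F hx
  have ha₁ : a ∈ Icc a c₁ := left_mem_Icc.2 h₁.le
  have hc₁ : c₁ ∈ Icc a c₁ := right_mem_Icc.2 h₁.le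
  have hFc₁ : F c₁ ≤ c₁ := (hK ⟨h₁.le, by linarith⟩).2
  have haF : a ≤ F c₁ := (hK ⟨h₁.le, by linarith⟩).1
  have hka : k c₁ = a := by
    have ha' : a ∈ k '' Icc a c₁ := hkimg ▸ left_mem_Icc.2 haF
    obtain ⟨x, hx, hxa⟩ := ha'
    refine le_antisymm ?_ (hkm hc₁).1
    calc k c₁ ≤ k x := hk.antitoneOn hx hc₁ hx.2
      _ = a := hxa
  have hk'a : k' a = c₁ := by simpa only [hka] using hk'k c₁ hc₁
  have hkF : F c₁ = k a := by rw [← hkk c₁ hc₁, hka]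
  have hk'F : k' (F c₁) = a := by rw [hkF, hk'k a ha₁]
  have hGa : G (k a) = c₁ := by rw [← hkF, hGF c₁ (left_mem_Icc.2 h₂.le)]
  have hFb : MapsTo F (Icc c₂ b) (Icc a c₁) := fun x hx => hK ⟨by linarith [hx.1], hx.2⟩
  classical
  let f : ℝ → ℝ := fun x => if x ≤ c₁ then k x else if x ≤ c₂ then k' (F x) else G (k (F x))
  have hf₁ : EqOn f k (Icc a c₁) := fun x hx => if_pos hx.2
  have hf₂ : EqOn f (fun x => k' (F x)) (Icc c₁ c₂) := fun x hx => by
    rcases hx.1.eq_or_lt with rfl | h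
    · rw [hf₁ hc₁, hka]; exact hk'F.symm
    · simp only [f, if_neg h.not_ge, if_pos hx.2]
  have hf₃ : EqOn f (fun x => G (k (F x))) (Icc c₂ b) := fun x hx => by
    rcases hx.1.eq_or_lt with rfl | h
    · rw [hf₂ (right_mem_Icc.2 h₂.le)]
      simp only [hFc₂, hk'a, hGa]
    · simp only [f, if_neg (h₂.trans h).not_ge, if_neg h.not_ge]
  have hsplit : Icc a c₁ ∪ Icc c₁ c₂ ∪ Icc c₂ b = Icc a b := by
    rw [Icc_union_Icc_eq_Icc h₁.le h₂.le,
      Icc_union_Icc_eq_Icc (h₁.trans h₂).le (h₃.le.trans hb)]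
  have hc : ContinuousOn f (Icc a b) := by
    rw [← hsplit]
    refine ContinuousOn.union_of_isClosed (ContinuousOn.union_of_isClosed ?_ ?_ isClosed_Icc
      isClosed_Icc) ?_ (isClosed_Icc.union isClosed_Icc) isClosed_Icc
    · exact hkc.congr hf₁
    · exact (hk'c.comp (hF.mono (Icc_subset_Icc h₁.le (h₃.le.trans hb))) hFm).congr hf₂
    · exact (hGc.comp (hkc.comp (hF.mono (Icc_subset_Icc_left (h₁.trans h₂).le)) hFb)
        (hkm.comp hFb)).congr hf₃
  have hsub : Icc a (F c₁) ⊆ Icc a c₁ := Icc_subset_Icc_right hFc₁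
  refine ⟨f, hc, ?_, ?_, ?_, ?_⟩
  · intro x hx
    rw [← hsplit] at hx
    rcases hx with (hx | hx) | hx
    · rw [hf₁ hx]
      exact Icc_subset_Icc_right (by linarith) (hkm hx)
    · rw [hf₂ hx]
      exact Icc_subset_Icc_right (by linarith) (hk'm (hFm hx))
    · rw [hf₃ hx]
      exact Icc_subset_Icc h₁.le (by linarith) (hGm (hkm (hFb hx)))
  · intro x hx
    rw [← hsplit] at hx
    rcases hx with (hx | hx) | hx
    · rw [hf₁ hx, hf₁ (hsub (hkm hx)), hkk x hx]
    · rw [hf₂ hx, hf₁ (hk'm (hFm hx)), hkk' _ (hFm hx)]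
    · rw [hf₃ hx, hf₂ (hGm (hkm (hFb hx)))]
      simp only [hFG _ (hkm (hFb hx)), hk'k _ (hFb hx)]
  · exact hk.congr hf₁.symm
  · rw [← Icc_union_Icc_eq_Icc h₂.le h₃.le]
    refine StrictMonoOn.union ?_ ?_ (isGreatest_Icc h₂.le) (isLeast_Icc h₃.le)
    · exact (hk'.comp hF₂ hFm).congr hf₂.symm
    · refine StrictMonoOn.congr (f₁ := fun x => G (k (F x))) ?_
        fun x hx => (hf₃ ⟨hx.1, hx.2.trans hb⟩).symm
      have hF₃m : MapsTo F (Icc c₂ c₃) (Icc a c₁) := hFb.mono_left (Icc_subset_Icc_right hb)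
      exact hG.comp (hk.comp_strictMonoOn hF₃ hF₃m) (hkm.comp hF₃m)

lemma IsFort.congr {a b x : ℝ} {F G : ℝ → ℝ} (h : EqOn F G (Icc a b)) (hx : IsFort a b F x) :
    IsFort a b G x :=
  ⟨hx.1, fun ε hε => ⟨fun hG => (hx.2 ε hε).1 (hG.congr (h.symm.mono inter_subset_left)),
    fun hG => (hx.2 ε hε).2 (hG.congr (h.symm.mono inter_subset_left))⟩⟩

lemma nForts_congr {a b : ℝ} {F G : ℝ → ℝ} (h : EqOn F G (Icc a b)) :
    nForts a b F = nForts a b G := by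
  unfold nForts
  congr 1
  ext x
  exact ⟨IsFort.congr h, IsFort.congr h.symm⟩

lemma nForts_comp {a b : ℝ} {F g : ℝ → ℝ} {K : Set ℝ} (hF : MapsTo F (Icc a b) K)
    (hg : StrictAntiOn g K) : nForts a b (g ∘ F) = nForts a b F := by
  have h1 : ∀ S ⊆ Icc a b, StrictMonoOn (g ∘ F) S ↔ StrictAntiOn F S := fun S hS =>
    forall₂_congr fun x hx => forall₂_congr fun y hy => forall_congr' fun _ =>
      hg.lt_iff_gt (hF (hS hx)) (hF (hS hy))
  have h2 : ∀ S ⊆ Icc a b, StrictAntiOn (g ∘ F) S ↔ StrictMonoOn F S := fun S hS =>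
    forall₂_congr fun x hx => forall₂_congr fun y hy => forall_congr' fun _ =>
      hg.lt_iff_gt (hF (hS hy)) (hF (hS hx))
  unfold nForts
  congr 1
  ext x
  refine and_congr_right fun _ => forall₂_congr fun ε _ => ?_
  rw [h1 _ inter_subset_left, h2 _ inter_subset_left, and_comm]

lemma not_isFort_of_mem_Ioo {a b p q x : ℝ} {F : ℝ → ℝ}
    (hF : StrictMonoOn F (Icc p q) ∨ StrictAntiOn F (Icc p q)) (hx : x ∈ Ioo p q) :
    ¬ IsFort a b F x := by
  intro h
  have hε : 0 < min (x - p) (q - x) := lt_min (sub_pos.2 hx.1) (sub_pos.2 hx.2)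
  have hsub : Icc a b ∩ Ioo (x - min (x - p) (q - x)) (x + min (x - p) (q - x)) ⊆ Icc p q := by
    rintro y ⟨-, hy⟩
    exact ⟨by linarith [hy.1, min_le_left (x - p) (q - x)],
      by linarith [hy.2, min_le_right (x - p) (q - x)]⟩
  exact hF.elim (fun hF => (h.2 _ hε).1 (hF.mono hsub)) fun hF => (h.2 _ hε).2 (hF.mono hsub)

/-- A turning point is a fort. -/
lemma isFort_of_strictAntiOn_of_strictMonoOn {a b p x q : ℝ} {F : ℝ → ℝ} (hp : a ≤ p)
    (hq : q ≤ b) (hx : x ∈ Ioo p q) (h₁ : StrictAntiOn F (Icc p x))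
    (h₂ : StrictMonoOn F (Icc x q)) : IsFort a b F x := by
  refine ⟨⟨hp.trans hx.1.le, hx.2.le.trans hq⟩, fun ε hε => ⟨fun h => ?_, fun h => ?_⟩⟩
  · obtain ⟨y, hy⟩ := exists_between (max_lt hx.1 (sub_lt_self x hε))
    have hpy := (le_max_left _ _).trans_lt hy.1
    have hεy := (le_max_right _ _).trans_lt hy.1
    refine (h₁ ⟨hpy.le, hy.2.le⟩ (right_mem_Icc.2 hx.1.le) hy.2).not_gt (h ?_ ?_ hy.2)
    · exact ⟨⟨by linarith, by linarith [hx.2, hy.2]⟩, hεy, by linarith [hy.2]⟩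
    · exact ⟨⟨by linarith [hx.1], by linarith [hx.2]⟩, by linarith, by linarith⟩
  · obtain ⟨y, hy⟩ := exists_between (lt_min hx.2 (lt_add_of_pos_right x hε))
    have hyq := hy.2.trans_le (min_le_left _ _)
    have hyε := hy.2.trans_le (min_le_right _ _)
    refine (h₂ (left_mem_Icc.2 hx.2.le) ⟨hy.1.le, hyq.le⟩ hy.1).not_gt (h ?_ ?_ hy.1)
    · exact ⟨⟨by linarith [hx.1], by linarith [hx.2]⟩, by linarith, by linarith⟩
    · exact ⟨⟨by linarith [hx.1, hy.1], by linarith⟩, by linarith [hy.1], hyε⟩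

/-- Forts of a continuous map are forts of its second iterate. -/
lemma IsFort.of_root {a b x : ℝ} {f F : ℝ → ℝ} (hf : ContinuousOn f (Icc a b))
    (hff : ∀ y ∈ Icc a b, f (f y) = F y) (hx : IsFort a b f x) : IsFort a b F x := by
  have key : ∀ ε, 0 < ε → ¬ InjOn F (Icc a b ∩ Ioo (x - ε) (x + ε)) := by
    intro ε hε hinj
    set p := max a (x - ε / 2)
    set q := min b (x + ε / 2)
    have hpx : p ≤ x := max_le hx.1.1 (by linarith)
    have hxq : x ≤ q := le_min hx.1.2 (by linarith)
    have hap : a ≤ p := le_max_left _ _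
    have hqb : q ≤ b := min_le_left _ _
    have hpε : x - ε / 2 ≤ p := le_max_right _ _
    have hqε : q ≤ x + ε / 2 := min_le_right _ _
    have hsub : Icc p q ⊆ Icc a b := Icc_subset_Icc hap hqb
    have hfinj : InjOn f (Icc p q) := fun y hy z hz hyz =>
      hinj ⟨hsub hy, by linarith [hy.1], by linarith [hy.2]⟩
        ⟨hsub hz, by linarith [hz.1], by linarith [hz.2]⟩
        (by rw [← hff y (hsub hy), ← hff z (hsub hz), hyz])
    have hsub' : Icc a b ∩ Ioo (x - ε / 2) (x + ε / 2) ⊆ Icc p q := fun y hy =>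
      ⟨max_le hy.1.1 hy.2.1.le, le_min hy.1.2 hy.2.2.le⟩
    rcases (hf.mono hsub).strictMonoOn_of_injOn_Icc' (hpx.trans hxq) hfinj with h | h
    · exact (hx.2 _ (half_pos hε)).1 (h.mono hsub')
    · exact (hx.2 _ (half_pos hε)).2 (h.mono hsub')
  exact ⟨hx.1, fun ε hε => ⟨fun h => key ε hε h.injOn, fun h => key ε hε h.injOn⟩⟩

lemma nForts_id (a b : ℝ) : nForts a b id = 0 := by
  have : {x | IsFort a b id x} = ∅ :=
    eq_empty_of_forall_notMem fun x hx => (hx.2 1 one_pos).1 (strictMono_id.strictMonoOn _)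
  rw [nForts, this, ncard_empty]

lemma PMFun.finite_forts {a b : ℝ} {F : ℝ → ℝ} {v : ℕ} {c : ℕ → ℝ} (h : PMFun a b F v c) :
    {x | IsFort a b F x}.Finite := by
  refine ((finite_Iic (v + 1)).image c).subset fun x hx => ?_
  have key : ∀ n, x ∈ Icc (c 0) (c (n + 1)) → ∃ i ≤ n, x ∈ Icc (c i) (c (i + 1)) := by
    intro n
    induction n with
    | zero => exact fun hx => ⟨0, le_rfl, hx⟩
    | succ n ih =>
      intro hx
      rcases le_total x (c (n + 1)) with h | h
      · obtain ⟨i, hi, hxi⟩ := ih ⟨hx.1, h⟩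
        exact ⟨i, hi.trans n.le_succ, hxi⟩
      · exact ⟨n + 1, le_rfl, h, hx.2⟩
  obtain ⟨i, hi, hxi⟩ := key v (by rw [h.c_zero, h.c_last]; exact hx.1)
  rcases hxi.1.eq_or_lt with h1 | h1
  · exact ⟨i, hi.trans v.le_succ, h1⟩
  rcases hxi.2.eq_or_lt with h2 | h2
  · exact ⟨i + 1, Nat.succ_le_succ hi, h2.symm⟩
  exact (not_isFort_of_mem_Ioo (h.lap_mono i hi) ⟨h1, h2⟩ hx).elim

/-- Theorem 2.3, first-lap case, root decreasing on the
characteristic interval. -/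
theorem stmt2 (a b : ℝ) (F : ℝ → ℝ) (v : ℕ) (c : ℕ → ℝ)
    (hPM : PMFun a b F v c) (hv : 2 ≤ v)
    (hK : Set.MapsTo F (Set.Icc a b) (Set.Icc (c 0) (c 1)))
    (hinc : StrictMonoOn F (Set.Icc (c 0) (c 1)))
    (hrev : RevCorr (c 0) (c 1) F)
    (h0 : c 0 < F (c 0)) (h1 : F (c 1) < c 1) (h2 : F (c 2) = c 0) :
    ∃ f : ℝ → ℝ, ContinuousOn f (Set.Icc a b) ∧
      Set.MapsTo f (Set.Icc a b) (Set.Icc a b) ∧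
      (∀ x ∈ Set.Icc a b, f (f x) = F x) ∧
      StrictAntiOn f (Set.Icc (c 0) (c 1)) ∧
      HeightEq a b f 2 := by
  have hle : ∀ j ≤ v + 1, c j ≤ b := by
    intro j hj
    have : ∀ n, j ≤ n → n ≤ v + 1 → c j ≤ c n := by
      intro n hn
      induction n, hn using Nat.le_induction with
      | base => exact fun _ => le_rfl
      | succ n _ ih => exact fun h => (ih (by omega)).trans (hPM.c_mono n (by omega)).le
    exact hPM.c_last ▸ this (v + 1) hj le_rfl
  have h01 : c 0 < c 1 := hPM.c_mono 0 (by omega)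
  have h12 : c 1 < c 2 := hPM.c_mono 1 (by omega)
  have h23 : c 2 < c 3 := hPM.c_mono 2 hv
  have h3b : c 3 ≤ b := hle 3 (by omega)
  have hfort : IsFort a b F (c 2) := hPM.fort 2 (by omega) hv
  have hFin := hPM.finite_forts
  have hF := hPM.cont
  have ha := hPM.c_zero
  subst ha
  have hF₂ : StrictAntiOn F (Icc (c 1) (c 2)) := by
    refine (hPM.lap_mono 1 (by omega)).resolve_left fun h => ?_
    have := h (left_mem_Icc.2 h12.le) (right_mem_Icc.2 h12.le) h12
    rw [h2] at this
    exact this.not_ge (hK ⟨h01.le, by linarith⟩).1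
  have hF₃ : StrictMonoOn F (Icc (c 2) (c 3)) := by
    refine (hPM.lap_mono 2 hv).resolve_right fun h => ?_
    have := h (left_mem_Icc.2 h23.le) (right_mem_Icc.2 h23.le) h23
    rw [h2] at this
    exact this.not_ge (hK ⟨by linarith, h3b⟩).1
  obtain ⟨k, hk, hkimg, hkk⟩ := hrev.exists_anti_root h0 h1
  obtain ⟨f, hfc, hfm, hff, hf₁, hf₂⟩ :=
    exists_root_extension h01 h12 h23 h3b hF hK hF₂ hF₃ h2 hk hkimg hkk
  have hN2 : nForts (c 0) b (f^[2]) = nForts (c 0) b F := nForts_congr hff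
  have hN3 : nForts (c 0) b (f^[3]) = nForts (c 0) b F :=
    (nForts_congr (G := f ∘ F) fun x hx => congrArg f (hff x hx)).trans (nForts_comp hK hf₁)
  have hsub : {x | IsFort (c 0) b f x} ⊆ {x | IsFort (c 0) b F x} := fun x hx =>
    IsFort.of_root hfc hff hx
  have hlt : nForts (c 0) b f < nForts (c 0) b F := by
    refine ncard_lt_ncard (hsub.ssubset_of_mem_notMem hfort ?_) hFin
    exact not_isFort_of_mem_Ioo (Or.inl hf₂) ⟨h12, h23⟩
  have hpos : 0 < nForts (c 0) b f := by
    rw [nForts, ncard_pos (hFin.subset hsub)]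
    exact ⟨c 1, isFort_of_strictAntiOn_of_strictMonoOn le_rfl h3b ⟨h01, h12.trans h23⟩ hf₁ hf₂⟩
  refine ⟨f, hfc, hfm, hff, hf₁, hN2.trans hN3.symm, fun i hi => ?_⟩
  by_contra! h
  have hi' : nForts (c 0) b (f^[i]) = nForts (c 0) b (f^[i + 1]) := hi
  interval_cases i
  · rw [iterate_zero, nForts_id, zero_add, iterate_one] at hi'
    exact hpos.ne hi'
  · rw [iterate_one, hN2] at hi'
    exact hlt.ne hi'
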